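/- arXiv:1702.00464 — 6 statements merged into one kernel-verified Lean document; each statement's English description precedes it below -/
import Mathlib

section
/- The sequence of measures dt·δ_{u_n(t)}(da) on [0,1] × [−1,1] converges weakly to the measure dt ⊗ (1/2)(δ_{−1} + δ_{1})(da): for every bounded continuous function f : [0,1] × [−1,1] → ℝ, ∫₀¹ f(t, u_n(t)) dt converges, as n → ∞, to ∫₀¹ (1/2)(f(t,−1) + f(t,1)) dt. -/
open MeasureTheory Set Filter

/-- The `n`-th Rademacher function: `u_n(t) = (-1)^k` for `t ∈ [k/n, (k+1)/n)`. -/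
noncomputable def rademacher (n : ℕ) (t : ℝ) : ℝ := (-1 : ℝ) ^ ⌊(n : ℝ) * t⌋

lemma measurable_rademacher (n : ℕ) : Measurable (rademacher n) := by
  have h : Measurable fun k : ℤ => (-1 : ℝ) ^ k := measurable_from_top
  exact h.comp (Int.measurable_floor.comp (measurable_const_mul (n : ℝ)))

lemma rademacher_eq_one_or_neg_one (n : ℕ) (t : ℝ) :
    rademacher n t = 1 ∨ rademacher n t = -1 := by
  rcases Int.even_or_odd ⌊(n : ℝ) * t⌋ with h | h
  · exact Or.inl h.neg_one_zpow
  · exact Or.inr h.neg_one_zpow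

lemma abs_rademacher (n : ℕ) (t : ℝ) : |rademacher n t| = 1 := by
  rcases rademacher_eq_one_or_neg_one n t with h | h <;> simp [h]

lemma rademacher_sub_inv {n : ℕ} (hn : n ≠ 0) (t : ℝ) :
    rademacher n (t - (n : ℝ)⁻¹) = -rademacher n t := by
  have hn' : (n : ℝ) ≠ 0 := Nat.cast_ne_zero.mpr hn
  have h : (n : ℝ) * (t - (n : ℝ)⁻¹) = n * t - 1 := by field_simp
  rw [rademacher, rademacher, h, Int.floor_sub_one, zpow_sub_one₀ (by norm_num)]
  norm_num

/-- Rademacher functions tested against an integrable function are controlled by the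
`L¹` modulus of continuity of the latter. -/
lemma abs_integral_mul_rademacher_le {G : ℝ → ℝ} (hG : Integrable G) {n : ℕ} (hn : n ≠ 0) :
    |∫ t, G t * rademacher n t| ≤ ∫ t, |G t - G (t - (n : ℝ)⁻¹)| := by
  have hint : ∀ {H : ℝ → ℝ}, Integrable H → Integrable fun t => H t * rademacher n t :=
    fun hH => hH.mul_bdd (c := 1) (measurable_rademacher n).aestronglyMeasurable
      (ae_of_all _ fun t => (abs_rademacher n t).le)
  have hG' : Integrable fun t => G (t - (n : ℝ)⁻¹) := hG.comp_sub_right _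
  have hshift : ∫ t, G (t - (n : ℝ)⁻¹) * rademacher n t = -∫ t, G t * rademacher n t := by
    rw [← integral_sub_right_eq_self (fun t => G t * rademacher n t) (n : ℝ)⁻¹, ← integral_neg]
    simp [rademacher_sub_inv hn]
  have hsum : ∫ t, (G t - G (t - (n : ℝ)⁻¹)) * rademacher n t =
      2 * ∫ t, G t * rademacher n t := by
    simp_rw [sub_mul]
    rw [integral_sub (hint hG) (hint hG'), hshift]
    ring
  have hle : |∫ t, (G t - G (t - (n : ℝ)⁻¹)) * rademacher n t| ≤
      ∫ t, |G t - G (t - (n : ℝ)⁻¹)| := by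
    refine abs_integral_le_integral_abs.trans_eq ?_
    simp [abs_mul, abs_rademacher]
  rw [hsum, abs_mul, abs_two] at hle
  linarith [abs_nonneg (∫ t, G t * rademacher n t)]

lemma tendsto_integral_mul_rademacher {g : ℝ → ℝ} (hg : Continuous g) {C : ℝ}
    (hC : ∀ t, |g t| ≤ C) :
    Tendsto (fun n : ℕ => ∫ t in (0 : ℝ)..1, g t * rademacher n t) atTop (nhds 0) := by
  set G : ℝ → ℝ := (Ioc (0 : ℝ) 1).indicator g with hGdef
  have hC0 : 0 ≤ C := (abs_nonneg _).trans (hC 0)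
  have hGm : Measurable G := hg.measurable.indicator measurableSet_Ioc
  have hGint : Integrable G :=
    (integrable_indicator_iff measurableSet_Ioc).mpr
      ((intervalIntegrable_iff_integrableOn_Ioc_of_le zero_le_one).mp (hg.intervalIntegrable 0 1))
  have hGC : ∀ t, |G t| ≤ C := fun t => by
    by_cases ht : t ∈ Ioc (0 : ℝ) 1
    · simpa [hGdef, ht] using hC t
    · simpa [hGdef, ht] using hC0
  have hinv : Tendsto (fun n : ℕ => (n : ℝ)⁻¹) atTop (nhds 0) :=
    tendsto_inv_atTop_nhds_zero_nat
  have hlim : Tendsto (fun n : ℕ => ∫ t, |G t - G (t - (n : ℝ)⁻¹)|) atTop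
      (nhds (∫ _ : ℝ, (0 : ℝ))) := by
    refine tendsto_integral_filter_of_dominated_convergence
      ((Icc (0 : ℝ) 2).indicator fun _ => 2 * C) ?_ ?_ ?_ ?_
    · exact Eventually.of_forall fun n =>
        (hGm.sub (hGm.comp (measurable_id.sub_const _))).abs.aestronglyMeasurable
    · filter_upwards [eventually_ge_atTop 1] with n hn
      refine ae_of_all _ fun t => ?_
      have h0 : 0 ≤ (n : ℝ)⁻¹ := by positivity
      have h1 : (n : ℝ)⁻¹ ≤ 1 := inv_le_one_of_one_le₀ (by exact_mod_cast hn)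
      by_cases ht : t ∈ Icc (0 : ℝ) 2
      · rw [indicator_of_mem ht, Real.norm_eq_abs, abs_abs]
        linarith [abs_sub (G t) (G (t - (n : ℝ)⁻¹)), hGC t, hGC (t - (n : ℝ)⁻¹)]
      · have ht1 : t ∉ Ioc (0 : ℝ) 1 := fun h => ht ⟨h.1.le, by linarith [h.2]⟩
        have ht2 : t - (n : ℝ)⁻¹ ∉ Ioc (0 : ℝ) 1 := fun h =>
          ht ⟨by linarith [h.1], by linarith [h.2]⟩
        simp [hGdef, ht, ht1, ht2]
    · exact (integrable_indicator_iff measurableSet_Icc).mpr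
        (integrableOn_const (by simp))
    · have hae : ∀ᵐ t : ℝ, t ∉ ({0, 1} : Set ℝ) :=
        measure_eq_zero_iff_ae_notMem.mp ((Set.toFinite ({0, 1} : Set ℝ)).measure_zero volume)
      filter_upwards [hae] with t ht
      have hcont : ContinuousAt G t := by
        refine hg.continuousOn.continuousAt_indicator ?_
        rwa [frontier_Ioc zero_lt_one]
      have h1 : Tendsto (fun n : ℕ => t - (n : ℝ)⁻¹) atTop (nhds t) := by
        simpa using hinv.const_sub t
      simpa using ((hcont.tendsto.comp h1).const_sub (G t)).abs
  rw [integral_zero] at hlim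
  refine squeeze_zero_norm' ?_ hlim
  filter_upwards [eventually_ne_atTop 0] with n hn
  have hrepr : ∫ t in (0 : ℝ)..1, g t * rademacher n t = ∫ t, G t * rademacher n t := by
    rw [intervalIntegral.integral_of_le zero_le_one, ← integral_indicator measurableSet_Ioc]
    simp_rw [hGdef, indicator_mul_left]
  rw [hrepr, Real.norm_eq_abs]
  exact abs_integral_mul_rademacher_le hGint hn

/-- The measures `dt·δ_{u_n(t)}(da)` on `[0,1] × [-1,1]` converge weakly to
`dt ⊗ (1/2)(δ_{-1} + δ_1)(da)`: for every bounded continuous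
`f : [0,1] × [-1,1] → ℝ`, `∫₀¹ f(t, u_n(t)) dt → ∫₀¹ (1/2)(f(t,-1) + f(t,1)) dt`. -/
theorem rademacher_weak_convergence
    (f : ℝ → ℝ → ℝ) (hf : Continuous (Function.uncurry f))
    (hbd : ∃ C : ℝ, ∀ t a, |f t a| ≤ C) :
    Tendsto (fun n : ℕ => ∫ t in (0:ℝ)..1, f t (rademacher n t)) atTop
      (nhds (∫ t in (0:ℝ)..1, (f t (-1) + f t 1) / 2)) := by
  obtain ⟨C, hC⟩ := hbd
  have hsec : ∀ a, Continuous fun t => f t a := fun a =>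
    hf.comp (continuous_id.prodMk continuous_const)
  have hmean : Continuous fun t => (f t (-1) + f t 1) / 2 :=
    ((hsec (-1)).add (hsec 1)).div_const 2
  have hdiff : Continuous fun t => (f t 1 - f t (-1)) / 2 :=
    ((hsec 1).sub (hsec (-1))).div_const 2
  have hbound : ∀ t, |(f t 1 - f t (-1)) / 2| ≤ C := fun t => by
    have h1 := abs_le.mp (hC t 1)
    have h2 := abs_le.mp (hC t (-1))
    exact abs_le.mpr ⟨by linarith, by linarith⟩
  have hsplit : ∀ n : ℕ, ∫ t in (0:ℝ)..1, f t (rademacher n t) =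
      (∫ t in (0:ℝ)..1, (f t (-1) + f t 1) / 2) +
        ∫ t in (0:ℝ)..1, (f t 1 - f t (-1)) / 2 * rademacher n t := fun n => by
    have hint : IntervalIntegrable (fun t => (f t 1 - f t (-1)) / 2 * rademacher n t)
        volume 0 1 := by
      rw [intervalIntegrable_iff]
      exact (hdiff.intervalIntegrable 0 1).def'.mul_bdd (c := 1)
        (measurable_rademacher n).aestronglyMeasurable
        (ae_of_all _ fun t => (abs_rademacher n t).le)
    rw [← intervalIntegral.integral_add (hmean.intervalIntegrable 0 1) hint]
    refine intervalIntegral.integral_congr fun t _ => ?_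
    rcases rademacher_eq_one_or_neg_one n t with h | h <;> simp only [h] <;> ring
  simp_rw [hsplit]
  simpa using (tendsto_integral_mul_rademacher hdiff hbound).const_add
    (∫ t in (0:ℝ)..1, (f t (-1) + f t 1) / 2)
end

section
/- On the set V, weak convergence implies stable convergence: if μ_n, μ ∈ V and μ_n → μ weakly, then for every bounded Borel measurable function f : [0,T] × A → ℝ such that f(t,·) : A → ℝ is continuous for every t ∈ [0,T], one has ∫_{[0,T]×A} f dμ_n → ∫_{[0,T]×A} f dμ. -/
open MeasureTheory Set Filter Topology

/-- A map into `C(X, E)` with `X` compact and separable is measurable as soon as all its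
evaluations are. -/
theorem ContinuousMap.measurable_of_measurable_eval {Ω X E : Type*} [MeasurableSpace Ω]
    [TopologicalSpace X] [CompactSpace X] [TopologicalSpace.SeparableSpace X]
    [NormedAddCommGroup E] [MeasurableSpace E] [BorelSpace E]
    [MeasurableSpace C(X, E)] [BorelSpace C(X, E)] [SecondCountableTopology C(X, E)]
    {F : Ω → C(X, E)} (hF : ∀ x, Measurable fun ω => F ω x) : Measurable F := by
  obtain ⟨s, hs, hsd⟩ := TopologicalSpace.exists_countable_dense X
  have hball (g : C(X, E)) (r : ENNReal) : MeasurableSet (F ⁻¹' Metric.eball g r) := by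
    have hm : Measurable fun ω => ‖F ω - g‖ₑ := by
      refine measurable_of_Iic fun c => ?_
      have hset : (fun ω => ‖F ω - g‖ₑ) ⁻¹' Iic c =
          ⋂ x ∈ s, (fun ω => F ω x) ⁻¹' {e | ‖e - g x‖ₑ ≤ c} := by
        ext ω
        simp only [mem_preimage, mem_Iic, mem_iInter, mem_ofPred_eq,
          ContinuousMap.enorm_eq_iSup_enorm, iSup_le_iff, ContinuousMap.sub_apply]
        refine ⟨fun h x _ => h x, fun h x => ?_⟩
        have hcl : IsClosed {x | ‖F ω x - g x‖ₑ ≤ c} :=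
          isClosed_le (by fun_prop) continuous_const
        exact hcl.closure_subset_iff.2 h (hsd x)
      rw [hset]
      refine MeasurableSet.biInter hs fun x _ => hF x ?_
      exact (isClosed_le (by fun_prop) continuous_const).measurableSet
    have hpre : F ⁻¹' Metric.eball g r = (fun ω => ‖F ω - g‖ₑ) ⁻¹' Iio r := by
      ext ω
      simp [edist_eq_enorm_sub]
    rw [hpre]
    exact hm measurableSet_Iio
  refine measurable_of_isOpen fun U hU => ?_
  choose! r hr hrU using fun g (hg : g ∈ U) => EMetric.isOpen_iff.1 hU g hg
  obtain ⟨D, hDU, hD, hDcov⟩ := TopologicalSpace.countable_cover_nhdsWithin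
    (f := fun g => Metric.eball g (r g)) (s := U)
    fun g hg => mem_nhdsWithin_of_mem_nhds (Metric.eball_mem_nhds g (hr g hg))
  have hUeq : U = ⋃ g ∈ D, Metric.eball g (r g) :=
    hDcov.antisymm (iUnion₂_subset fun g hg => hrU g (hDU hg))
  rw [hUeq, preimage_iUnion₂]
  exact MeasurableSet.biUnion hD fun g _ => hball g (r g)

/-- Integrals of two fibrewise continuous functions against a measure with first marginal `ν`
differ by at most the `L¹(ν; C(A, ℝ))` distance of the functions. -/
theorem abs_integral_sub_le_of_map_fst {S A : Type*} [MeasurableSpace S]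
    [TopologicalSpace A] [CompactSpace A] [MeasurableSpace A]
    {ρ : Measure (S × A)} {ν : Measure S} (hρ : ρ.map Prod.fst = ν)
    {F G : S → C(A, ℝ)} (hFG : Integrable (fun t => F t - G t) ν)
    (hF : Integrable (fun p : S × A => F p.1 p.2) ρ)
    (hG : Integrable (fun p : S × A => G p.1 p.2) ρ) :
    |∫ p, F p.1 p.2 ∂ρ - ∫ p, G p.1 p.2 ∂ρ| ≤ ∫ t, ‖F t - G t‖ ∂ν := by
  subst hρ
  rw [← integral_sub hF hG, integral_map measurable_fst.aemeasurable hFG.norm.1]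
  exact norm_integral_le_of_norm_le (hFG.norm.comp_measurable measurable_fst)
    (ae_of_all _ fun p => (F p.1 - G p.1).norm_coe_le_norm p.2)

/-- On the set `V` of finite measures on `[0,T] × A` with time-marginal Lebesgue,
weak convergence implies stable convergence: if `μn → μ` weakly in `V`, then for every
bounded Borel measurable `f : [0,T] × A → ℝ` with `f(t,·)` continuous for each `t ∈ [0,T]`,
`∫ f dμn → ∫ f dμ`. -/
theorem weak_implies_stable_convergence (T : ℝ) (hT : 0 < T)
    (A : Type*) [MetricSpace A] [CompactSpace A] [MeasurableSpace A] [BorelSpace A]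
    (μn : ℕ → MeasureTheory.FiniteMeasure (ℝ × A)) (μ : MeasureTheory.FiniteMeasure (ℝ × A))
    (hμn : ∀ n, ((μn n : MeasureTheory.Measure (ℝ × A)).map Prod.fst =
        MeasureTheory.volume.restrict (Set.Icc 0 T)))
    (hμ : (μ : MeasureTheory.Measure (ℝ × A)).map Prod.fst =
        MeasureTheory.volume.restrict (Set.Icc 0 T))
    (hconv : Filter.Tendsto μn Filter.atTop (nhds μ))
    (f : ℝ × A → ℝ) (hmeas : Measurable f)
    (hbd : ∃ C : ℝ, ∀ p ∈ Set.Icc (0:ℝ) T ×ˢ (Set.univ : Set A), |f p| ≤ C)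
    (hcont : ∀ t ∈ Set.Icc (0:ℝ) T, Continuous fun a => f (t, a)) :
    Filter.Tendsto (fun n => ∫ p, f p ∂(μn n : MeasureTheory.Measure (ℝ × A)))
      Filter.atTop (nhds (∫ p, f p ∂(μ : MeasureTheory.Measure (ℝ × A)))) := by
  set ν : Measure ℝ := volume.restrict (Icc 0 T)
  obtain ⟨C, hC⟩ := hbd
  borelize C(A, ℝ)
  let F : ℝ → C(A, ℝ) := fun t => if h : t ∈ Icc 0 T then ⟨fun a => f (t, a), hcont t h⟩ else 0
  have hFf {t : ℝ} (ht : t ∈ Icc 0 T) (a : A) : F t a = f (t, a) := by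
    simp only [F, dif_pos ht, ContinuousMap.coe_mk]
  have hF0 {t : ℝ} (ht : t ∉ Icc 0 T) : F t = 0 := dif_neg ht
  have hFmeas : Measurable F := by
    refine ContinuousMap.measurable_of_measurable_eval fun a => ?_
    have hind : (fun t => F t a) = (Icc 0 T).indicator fun t => f (t, a) := by
      ext t
      by_cases ht : t ∈ Icc 0 T
      · rw [hFf ht, indicator_of_mem ht]
      · rw [hF0 ht, indicator_of_notMem ht, ContinuousMap.zero_apply]
    rw [hind]
    exact (hmeas.comp measurable_prodMk_right).indicator measurableSet_Icc
  have hFbd (t : ℝ) : ‖F t‖ ≤ |C| := by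
    refine (ContinuousMap.norm_le _ (abs_nonneg C)).2 fun a => ?_
    by_cases ht : t ∈ Icc 0 T
    · rw [hFf ht]
      exact (hC (t, a) ⟨ht, mem_univ a⟩).trans (le_abs_self C)
    · simp [hF0 ht]
  have hFint : Integrable F ν :=
    .of_bound hFmeas.aestronglyMeasurable |C| (ae_of_all _ hFbd)
  have hae {ρ : FiniteMeasure (ℝ × A)} (hρ : (ρ : Measure (ℝ × A)).map Prod.fst = ν) :
      f =ᵐ[(ρ : Measure (ℝ × A))] fun p => F p.1 p.2 := by
    have hmem : ∀ᵐ t ∂(ρ : Measure (ℝ × A)).map Prod.fst, t ∈ Icc 0 T := by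
      rw [hρ]
      exact ae_restrict_mem measurableSet_Icc
    filter_upwards [ae_of_ae_map measurable_fst.aemeasurable hmem] with p hp
    exact (hFf hp p.2).symm
  have hclose {ρ : FiniteMeasure (ℝ × A)} (hρ : (ρ : Measure (ℝ × A)).map Prod.fst = ν)
      {g : BoundedContinuousFunction ℝ C(A, ℝ)} (hg : Integrable g ν)
      {G : BoundedContinuousFunction (ℝ × A) ℝ}
      (hG : ∀ p, G p = g p.1 p.2) :
      |∫ p, f p ∂(ρ : Measure (ℝ × A)) - ∫ p, G p ∂(ρ : Measure (ℝ × A))| ≤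
        ∫ t, ‖F t - g t‖ ∂ν := by
    have hFρ : Integrable (fun p : ℝ × A => F p.1 p.2) (ρ : Measure (ℝ × A)) :=
      .of_bound (hmeas.aestronglyMeasurable.congr (hae hρ)) |C|
        (ae_of_all _ fun p => ((F p.1).norm_coe_le_norm p.2).trans (hFbd p.1))
    rw [integral_congr_ae (hae hρ)]
    simp_rw [hG]
    exact abs_integral_sub_le_of_map_fst hρ (hFint.sub hg) hFρ
      ((G.integrable _).congr (ae_of_all _ hG))
  refine Metric.tendsto_atTop.2 fun ε hε => ?_
  obtain ⟨g, hg, hgint⟩ := hFint.exists_boundedContinuous_integral_sub_le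
    (by positivity : 0 < ε / 4)
  let G : BoundedContinuousFunction (ℝ × A) ℝ := .ofNormedAddCommGroup (fun p => g p.1 p.2)
    (by fun_prop) ‖g‖
    fun p => ((g p.1).norm_coe_le_norm p.2).trans (g.norm_coe_le_norm p.1)
  obtain ⟨N, hN⟩ := Metric.tendsto_atTop.1
    (FiniteMeasure.tendsto_iff_forall_integral_tendsto.1 hconv G) (ε / 2) (by positivity)
  refine ⟨N, fun n hn => ?_⟩
  have hn' := hN n hn
  have h₁ := (hclose (hμn n) hgint (G := G) fun _ => rfl).trans hg
  have h₂ := (hclose hμ hgint (G := G) fun _ => rfl).trans hg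
  rw [Real.dist_eq] at hn' ⊢
  rw [abs_le] at h₁ h₂
  rw [abs_lt] at hn' ⊢
  constructor <;> linarith
end

section
/- (Chattering lemma, deterministic form.) For every μ ∈ V there exists a sequence of Borel measurable functions u_n : [0,T] → A such that the measures dt·δ_{u_n(t)}(da) (the pushforwards of Lebesgue measure on [0,T] under t ↦ (t, u_n(t))) converge weakly to μ. -/
open MeasureTheory Set Filter Topology

/-- A measure on a standard Borel space of total mass `b - a` is the pushforward of Lebesgue
measure on `[a, b]` under some measurable map. -/
theorem exists_measurable_map_restrict_Icc_eq {A : Type*} [MeasurableSpace A]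
    [StandardBorelSpace A] [Nonempty A] (a b : ℝ) (ν : Measure A)
    (hν : ν univ = ENNReal.ofReal (b - a)) :
    ∃ w : ℝ → A, Measurable w ∧ (volume.restrict (Icc a b)).map w = ν := by
  rcases le_or_gt b a with hab | hab
  · have hν0 : ν = 0 := by
      rw [← Measure.measure_univ_eq_zero, hν, ENNReal.ofReal_eq_zero]
      linarith
    have h0 : volume.restrict (Icc a b) = 0 := by
      rw [Measure.restrict_eq_zero, Real.volume_Icc, ENNReal.ofReal_eq_zero]
      linarith
    exact ⟨fun _ => Classical.arbitrary A, measurable_const, by rw [h0, hν0, Measure.map_zero]⟩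
  have hc : 0 < b - a := sub_pos.2 hab
  have hc0 : ENNReal.ofReal (b - a) ≠ 0 := by simpa using hab
  let ν' : Measure A := (ENNReal.ofReal (b - a))⁻¹ • ν
  have : IsProbabilityMeasure ν' := ⟨by
    simp only [ν', Measure.smul_apply, hν, smul_eq_mul]
    exact ENNReal.inv_mul_cancel hc0 ENNReal.ofReal_ne_top⟩
  obtain ⟨q, hq, hqν⟩ := ν'.exists_measurable_map_eq
  let ψ : ℝ → ℝ := fun x => (b - a) * x + a
  have hψ : Measurable ψ := by fun_prop
  let φ : ℝ → unitInterval := fun t => projIcc 0 1 zero_le_one ((t - a) / (b - a))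
  have hφ : Measurable φ :=
    continuous_projIcc.measurable.comp ((measurable_id.sub_const a).div_const (b - a))
  have hvol : volume.map ψ = ENNReal.ofReal (b - a)⁻¹ • (volume : Measure ℝ) := by
    have : ψ = (fun x => x + a) ∘ (fun x => (b - a) * x) := rfl
    rw [this, ← Measure.map_map (by fun_prop) (by fun_prop), Real.map_volume_mul_left hc.ne',
      Measure.map_smul, map_add_right_eq_self, abs_of_pos (inv_pos.2 hc)]
  have hpre : ψ ⁻¹' Icc a b = Icc 0 1 := by
    ext x
    simp only [ψ, mem_preimage, mem_Icc]
    constructor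
    · rintro ⟨h1, h2⟩
      constructor <;> nlinarith
    · rintro ⟨h1, h2⟩
      constructor <;> nlinarith
  have hIcc : volume.restrict (Icc a b)
      = ENNReal.ofReal (b - a) • (volume.restrict (Icc (0 : ℝ) 1)).map ψ := by
    rw [← hpre, ← Measure.restrict_map hψ measurableSet_Icc, hvol, Measure.restrict_smul,
      smul_smul, ← ENNReal.ofReal_mul hc.le, mul_inv_cancel₀ hc.ne', ENNReal.ofReal_one, one_smul]
  have hI : volume.restrict (Icc (0 : ℝ) 1)
      = (volume : Measure unitInterval).map Subtype.val :=
    (map_comap_subtype_coe measurableSet_Icc volume).symm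
  have hid : φ ∘ ψ ∘ Subtype.val = (id : unitInterval → unitInterval) := by
    funext x
    simp [φ, ψ, mul_div_cancel_left₀ _ hc.ne']
  refine ⟨q ∘ φ, hq.comp hφ, ?_⟩
  rw [← Measure.map_map hq hφ, hIcc, hI, Measure.map_map hψ measurable_subtype_coe,
    Measure.map_smul, Measure.map_map hφ (hψ.comp measurable_subtype_coe), hid, Measure.map_id,
    Measure.map_smul, hqν, smul_smul, ENNReal.mul_inv_cancel hc0 ENNReal.ofReal_ne_top, one_smul]

/-- If `μ` has Lebesgue measure on `[0, T]` as first marginal, then some measurable function `u`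
gives every cell `[kh, (k + 1)h)` the same distribution on `A` as `μ` does. -/
theorem exists_measurable_map_floor_eq {A : Type*} [MeasurableSpace A] [StandardBorelSpace A]
    [Nonempty A] (T h : ℝ) (hh : 0 < h) (μ : Measure (ℝ × A))
    (hμ : μ.map Prod.fst = volume.restrict (Icc 0 T)) :
    ∃ u : ℝ → A, Measurable u ∧
      (volume.restrict (Icc 0 T)).map (fun t => (⌊t / h⌋, u t))
        = μ.map (fun p => (⌊p.1 / h⌋, p.2)) := by
  let I : ℤ → Set ℝ := fun k => (fun t => ⌊t / h⌋) ⁻¹' {k}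
  have hfloor : Measurable fun t : ℝ => ⌊t / h⌋ := (measurable_id.div_const h).floor
  have hI : ∀ k, MeasurableSet (I k) := fun k => hfloor (measurableSet_singleton k)
  have hI_eq : ∀ k : ℤ, I k = Ico (k * h) ((k + 1) * h) := fun k => by
    ext t
    simp only [I, mem_preimage, mem_singleton_iff, Int.floor_eq_iff, mem_Ico, le_div_iff₀ hh,
      div_lt_iff₀ hh]
  have hcell : ∀ k : ℤ, (volume.restrict (Icc 0 T)).restrict (I k)
      = volume.restrict (Icc (max (k * h) 0) (min ((k + 1) * h) T)) := fun k => by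
    rw [Measure.restrict_restrict (hI k), hI_eq, ← Icc_inter_Icc]
    exact Measure.restrict_congr_set (Ico_ae_eq_Icc.inter (ae_eq_refl _))
  have hw : ∀ k : ℤ, ∃ w : ℝ → A, Measurable w ∧
      ((volume.restrict (Icc 0 T)).restrict (I k)).map w
        = (μ.restrict (Prod.fst ⁻¹' I k)).map Prod.snd := fun k => by
    rw [hcell]
    refine exists_measurable_map_restrict_Icc_eq _ _ _ ?_
    rw [Measure.map_apply measurable_snd MeasurableSet.univ, preimage_univ,
      Measure.restrict_apply_univ, ← Measure.map_apply measurable_fst (hI k), hμ,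
      ← Measure.restrict_apply_univ (I k), hcell, Measure.restrict_apply_univ, Real.volume_Icc]
  choose w hwm hw using hw
  let u : ℝ → A := fun t => w ⌊t / h⌋ t
  have hu : Measurable u :=
    (measurable_from_prod_countable_right (f := fun p : ℤ × ℝ => w p.1 p.2) hwm).comp
      (hfloor.prodMk measurable_id)
  refine ⟨u, hu, ?_⟩
  have huniv : ⋃ k : ℤ, (Prod.fst ⁻¹' {k} : Set (ℤ × A)) = univ := by
    ext p
    simp
  refine (Measure.ext_iff_of_iUnion_eq_univ huniv).2 fun k => ?_
  have hk : MeasurableSet (Prod.fst ⁻¹' {k} : Set (ℤ × A)) :=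
    measurable_fst (measurableSet_singleton k)
  have hcellA : Measurable fun p : ℝ × A => (⌊p.1 / h⌋, p.2) :=
    (hfloor.comp measurable_fst).prodMk measurable_snd
  rw [Measure.restrict_map (hfloor.prodMk hu) hk, Measure.restrict_map hcellA hk]
  change ((volume.restrict (Icc 0 T)).restrict (I k)).map _ = (μ.restrict (Prod.fst ⁻¹' I k)).map _
  have h1 : (fun t => (⌊t / h⌋, u t))
      =ᵐ[(volume.restrict (Icc 0 T)).restrict (I k)] Prod.mk k ∘ w k := by
    filter_upwards [ae_restrict_mem (hI k)] with t (ht : ⌊t / h⌋ = k)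
    simp [u, ht]
  have h2 : (fun p : ℝ × A => (⌊p.1 / h⌋, p.2))
      =ᵐ[μ.restrict (Prod.fst ⁻¹' I k)] Prod.mk k ∘ Prod.snd := by
    filter_upwards [ae_restrict_mem (measurable_fst (hI k))] with p (hp : ⌊p.1 / h⌋ = k)
    simp [hp]
  rw [Measure.map_congr h1, Measure.map_congr h2,
    ← Measure.map_map measurable_prodMk_left (hwm k),
    ← Measure.map_map measurable_prodMk_left measurable_snd, hw]

/-- Integrals of a bounded function along two uniformly close maps are close. -/
theorem abs_integral_comp_sub_le {Ω X : Type*} [MeasurableSpace Ω] [MeasurableSpace X]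
    {P : Measure Ω} [IsFiniteMeasure P] {f : X → ℝ} (hf : Measurable f) {C : ℝ}
    (hC : ∀ x, |f x| ≤ C) {g g' : Ω → X} (hg : Measurable g) (hg' : Measurable g') {δ : ℝ}
    (h : ∀ᵐ x ∂P, |f (g x) - f (g' x)| ≤ δ) :
    |∫ x, f (g x) ∂P - ∫ x, f (g' x) ∂P| ≤ δ * P.real univ := by
  have hint : ∀ {k : Ω → X}, Measurable k → Integrable (fun x => f (k x)) P := fun hk =>
    Integrable.of_bound (hf.comp hk).aestronglyMeasurable C (ae_of_all _ fun _ => hC _)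
  rw [← integral_sub (hint hg) (hint hg')]
  rw [← Real.norm_eq_abs]
  refine norm_integral_le_of_norm_le_const ?_
  simpa only [Real.norm_eq_abs] using h

/-- Chattering lemma (deterministic form): for every `μ ∈ V` (finite measure on
`[0,T] × A` with time-marginal Lebesgue) there is a sequence of Borel measurable
functions `u_n : [0,T] → A` such that the measures `dt·δ_{u_n(t)}(da)` converge
weakly to `μ`, i.e. `∫₀ᵀ f(t, u_n(t)) dt → ∫ f dμ` for every bounded continuous `f`. -/
theorem chattering_lemma (T : ℝ) (hT : 0 < T)
    (A : Type*) [MetricSpace A] [CompactSpace A] [MeasurableSpace A] [BorelSpace A]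
    (μ : MeasureTheory.Measure (ℝ × A))
    (hμ : μ.map Prod.fst = MeasureTheory.volume.restrict (Set.Icc 0 T)) :
    ∃ u : ℕ → ℝ → A, (∀ n, Measurable (u n)) ∧
      ∀ f : ℝ × A → ℝ, Continuous f → (∃ C : ℝ, ∀ p, |f p| ≤ C) →
        Filter.Tendsto
          (fun n => ∫ t in Set.Icc (0:ℝ) T, f (t, u n t) ∂MeasureTheory.volume)
          Filter.atTop (nhds (∫ p, f p ∂μ)) := by
  have hμ_univ : μ univ = ENNReal.ofReal T := by
    rw [← preimage_univ (f := Prod.fst), ← Measure.map_apply measurable_fst MeasurableSet.univ, hμ,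
      Measure.restrict_apply_univ, Real.volume_Icc, sub_zero]
  have : IsFiniteMeasure μ := ⟨by rw [hμ_univ]; exact ENNReal.ofReal_lt_top⟩
  have : Nonempty A := by
    by_contra hA
    rw [not_nonempty_iff] at hA
    rw [univ_eq_empty_iff.2 inferInstance, measure_empty] at hμ_univ
    exact (ENNReal.ofReal_pos.2 hT).ne hμ_univ
  have hae : ∀ᵐ p ∂μ, p.1 ∈ Icc 0 T := by
    have h : ∀ᵐ t ∂μ.map Prod.fst, t ∈ Icc 0 T := hμ ▸ ae_restrict_mem measurableSet_Icc
    exact ae_of_ae_map measurable_fst.aemeasurable h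
  have hpos : ∀ n : ℕ, (0 : ℝ) < 1 / ((n : ℝ) + 1) := fun n => Nat.one_div_pos_of_nat
  choose u hu hmap using fun n : ℕ => exists_measurable_map_floor_eq T _ (hpos n) μ hμ
  refine ⟨u, hu, fun f hf ⟨C, hC⟩ => ?_⟩
  let r : ℕ → ℤ → ℝ := fun n k => k * (1 / ((n : ℝ) + 1))
  have hr : ∀ n t, t ∈ Icc 0 T → r n ⌊t / (1 / ((n : ℝ) + 1))⌋ ∈ Icc 0 T ∧
      dist (r n ⌊t / (1 / ((n : ℝ) + 1))⌋) t ≤ 1 / ((n : ℝ) + 1) := fun n t ht => by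
    have h1 := (le_div_iff₀ (hpos n)).1 (Int.floor_le (t / (1 / ((n : ℝ) + 1))))
    have h2 := (div_lt_iff₀ (hpos n)).1 (Int.lt_floor_add_one (t / (1 / ((n : ℝ) + 1))))
    have h3 : (0 : ℝ) ≤ ⌊t / (1 / ((n : ℝ) + 1))⌋ :=
      Int.cast_nonneg (Int.floor_nonneg.2 (div_nonneg ht.1 (hpos n).le))
    refine ⟨⟨mul_nonneg h3 (hpos n).le, h1.trans ht.2⟩, ?_⟩
    rw [Real.dist_eq, abs_le]
    constructor <;> simp only [r] <;> linarith [hpos n]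
  have hr_meas : ∀ n, Measurable fun t : ℝ => r n ⌊t / (1 / ((n : ℝ) + 1))⌋ := fun n =>
    (measurable_of_countable (r n)).comp (measurable_id.div_const _).floor
  have hf_cell : ∀ n, Measurable fun p : ℤ × A => f (r n p.1, p.2) := fun n =>
    hf.measurable.comp
      (((measurable_of_countable (r n)).comp measurable_fst).prodMk measurable_snd)
  have hstep : ∀ n, ∫ t in Icc 0 T, f (r n ⌊t / (1 / ((n : ℝ) + 1))⌋, u n t)
      = ∫ p, f (r n ⌊p.1 / (1 / ((n : ℝ) + 1))⌋, p.2) ∂μ := fun n => by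
    have hfloor : Measurable fun t : ℝ => ⌊t / (1 / ((n : ℝ) + 1))⌋ :=
      (measurable_id.div_const _).floor
    have h1 := integral_map (μ := volume.restrict (Icc 0 T)) (hfloor.prodMk (hu n)).aemeasurable
      (hf_cell n).aestronglyMeasurable
    have h2 := integral_map (μ := μ)
      ((hfloor.comp measurable_fst).prodMk measurable_snd).aemeasurable
      (hf_cell n).aestronglyMeasurable
    rw [hmap n] at h1
    exact h1.symm.trans h2
  have huc : UniformContinuousOn f (Icc 0 T ×ˢ univ) :=
    (isCompact_Icc.prod isCompact_univ).uniformContinuousOn_of_continuous hf.continuousOn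
  rw [Metric.tendsto_atTop]
  intro ε hε
  have hη : 0 < ε / (4 * T) := by positivity
  obtain ⟨δ, hδ, hfδ⟩ := Metric.uniformContinuousOn_iff.1 huc _ hη
  obtain ⟨N, hN⟩ := exists_nat_one_div_lt hδ
  refine ⟨N, fun n hn => ?_⟩
  have hclose : ∀ t ∈ Icc 0 T, ∀ a : A,
      |f (t, a) - f (r n ⌊t / (1 / ((n : ℝ) + 1))⌋, a)| ≤ ε / (4 * T) := fun t ht a => by
    obtain ⟨hmem, hdist⟩ := hr n t ht
    refine (hfδ (t, a) ⟨ht, mem_univ _⟩ (_, a) ⟨hmem, mem_univ _⟩ ?_).le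
    rw [dist_prod_same_right, dist_comm]
    exact (hdist.trans (Nat.one_div_le_one_div hn)).trans_lt hN
  have e1 := abs_integral_comp_sub_le (P := volume.restrict (Icc 0 T)) hf.measurable hC
    (measurable_id.prodMk (hu n)) ((hr_meas n).prodMk (hu n)) (δ := ε / (4 * T)) <| by
      filter_upwards [ae_restrict_mem measurableSet_Icc] with t ht using hclose t ht _
  have e2 := abs_integral_comp_sub_le (P := μ) hf.measurable hC measurable_id
    (((hr_meas n).comp measurable_fst).prodMk measurable_snd) (δ := ε / (4 * T)) <| by
      filter_upwards [hae] with p hp using hclose p.1 hp _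
  have hvol : (volume.restrict (Icc 0 T)).real univ = T := by
    simp [measureReal_def, hT.le]
  have hμ_real : μ.real univ = T := by
    rw [measureReal_def, hμ_univ, ENNReal.toReal_ofReal hT.le]
  have hsmall : ε / (4 * T) * T = ε / 4 := by
    field_simp
  rw [hvol, hsmall] at e1
  rw [hμ_real, hsmall] at e2
  simp only [id, Function.comp_apply] at e1 e2
  rw [hstep] at e1
  rw [Real.dist_eq, abs_lt]
  rw [abs_le] at e1 e2
  constructor <;> linarith [e1.1, e1.2, e2.1, e2.2]
end

section
/- (Chattering lemma, part (ii).) Let u_n : [0,T] → A be Borel measurable functions such that the measures dt·δ_{u_n(t)}(da) converge weakly to μ ∈ V. Then for every bounded continuous function f : [0,T] × A → ℝ, ∫₀ᵗ f(s, u_n(s)) ds converges to ∫_{[0,t]×A} f(s,a) dμ(s,a) uniformly in t ∈ [0,T], i.e. sup_{t∈[0,T]} |∫₀ᵗ f(s,u_n(s)) ds − ∫_{[0,t]×A} f dμ| → 0 as n → ∞. -/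
open MeasureTheory Set Filter Topology

/-- If the first marginal of `ν` is Lebesgue measure on `[0, T]`, then the integrals of two functions
within `C` of each other that agree over `[0, T] \ (a, b]` differ by at most `C * (b - a)`. -/
theorem abs_integral_sub_integral_le_of_map_fst {X : Type*} [MeasurableSpace X] {T : ℝ}
    {ν : Measure (ℝ × X)} (hν : ν.map Prod.fst = volume.restrict (Icc 0 T))
    {g h : ℝ × X → ℝ} (hg : Integrable g ν) (hh : Integrable h ν) {C a b : ℝ} (hC : 0 ≤ C)
    (hab : a ≤ b) (hle : ∀ p, |g p - h p| ≤ C)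
    (heq : ∀ p : ℝ × X, p.1 ∈ Icc 0 T → p.1 ∉ Ioc a b → g p = h p) :
    |(∫ p, g p ∂ν) - ∫ p, h p ∂ν| ≤ C * (b - a) := by
  have hmeas : MeasurableSet (Prod.fst ⁻¹' Ioc a b : Set (ℝ × X)) :=
    measurable_fst measurableSet_Ioc
  have hνle : ν (Prod.fst ⁻¹' Ioc a b) ≤ ENNReal.ofReal (b - a) := by
    rw [← Measure.map_apply measurable_fst measurableSet_Ioc, hν, ← Real.volume_Ioc]
    exact Measure.restrict_apply_le _ _
  have hfin : ν (Prod.fst ⁻¹' Ioc a b) ≠ ⊤ := (hνle.trans_lt ENNReal.ofReal_lt_top).ne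
  have hae : ∀ᵐ p ∂ν, p.1 ∈ Icc 0 T := by
    apply ae_of_ae_map measurable_fst.aemeasurable
    rw [hν]
    exact ae_restrict_mem measurableSet_Icc
  rw [← integral_sub hg hh, ← Real.norm_eq_abs]
  calc ‖∫ p, (g p - h p) ∂ν‖
      ≤ ∫ p, (Prod.fst ⁻¹' Ioc a b).indicator (fun _ => C) p ∂ν := by
        refine norm_integral_le_of_norm_le ?_ ?_
        · exact (integrableOn_const hfin).integrable_indicator hmeas
        · filter_upwards [hae] with p hp
          by_cases hpab : p.1 ∈ Ioc a b
          · rw [indicator_of_mem (show p ∈ Prod.fst ⁻¹' Ioc a b from hpab)]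
            exact hle p
          · rw [indicator_of_notMem (show p ∉ Prod.fst ⁻¹' Ioc a b from hpab),
              heq p hp hpab, sub_self, norm_zero]
    _ = C * ν.real (Prod.fst ⁻¹' Ioc a b) := by
        rw [integral_indicator hmeas, setIntegral_const, smul_eq_mul, mul_comm]
    _ ≤ C * (b - a) := by
        gcongr
        exact ENNReal.toReal_le_of_le_ofReal (sub_nonneg.2 hab) hνle

theorem isFiniteMeasure_of_map_fst {X : Type*} [MeasurableSpace X] {T : ℝ}
    {ν : Measure (ℝ × X)} (hν : ν.map Prod.fst = volume.restrict (Icc 0 T)) :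
    IsFiniteMeasure ν := by
  have : IsFiniteMeasure (ν.map Prod.fst) := by rw [hν]; infer_instance
  exact Measure.isFiniteMeasure_of_map measurable_fst.aemeasurable

theorem lipschitzWith_setIntegral_Icc_prod_univ {X : Type*} [MeasurableSpace X] {T : ℝ}
    {ν : Measure (ℝ × X)} (hν : ν.map Prod.fst = volume.restrict (Icc 0 T))
    {f : ℝ × X → ℝ} (hf : Integrable f ν) {C : NNReal} (hC : ∀ p, |f p| ≤ C) :
    LipschitzWith C fun t : Icc (0 : ℝ) T => ∫ p in Icc (0 : ℝ) t ×ˢ (univ : Set X), f p ∂ν := by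
  have hm (t : ℝ) : MeasurableSet (Icc 0 t ×ˢ (univ : Set X)) :=
    measurableSet_Icc.prod MeasurableSet.univ
  have key (s t : ℝ) (hst : s ≤ t) :
      |(∫ p in Icc 0 s ×ˢ (univ : Set X), f p ∂ν) - ∫ p in Icc 0 t ×ˢ (univ : Set X), f p ∂ν|
        ≤ C * (t - s) := by
    rw [← integral_indicator (hm s), ← integral_indicator (hm t)]
    refine abs_integral_sub_integral_le_of_map_fst hν (hf.indicator (hm s)) (hf.indicator (hm t))
      C.2 hst (fun p => ?_) (fun p _ hp => ?_)
    · have := hC p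
      have h0 : (0 : ℝ) ≤ C := C.2
      simp only [indicator_apply, mem_prod, mem_univ, and_true, mem_Icc]
      split_ifs with h1 h2 h2
      · simp
      · exact absurd ⟨h1.1, h1.2.trans hst⟩ h2
      · simpa using this
      · simp
    · simp only [indicator_apply, mem_prod, mem_univ, and_true]
      simp only [mem_Ioc, mem_Icc] at *
      congr 1
      grind
  refine LipschitzWith.of_dist_le_mul fun s t => ?_
  rw [Subtype.dist_eq, Real.dist_eq, Real.dist_eq]
  rcases le_total (s : ℝ) t with h | h
  · rw [abs_sub_comm (s : ℝ), abs_of_nonneg (sub_nonneg.2 h)]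
    exact key s t h
  · rw [abs_sub_comm, abs_of_nonneg (sub_nonneg.2 h)]
    exact key t s h

/-- The piecewise linear function equal to `1` on `(-∞, t - δ]` and to `0` on `[t, ∞)`. -/
noncomputable def rampCutoff (t δ s : ℝ) : ℝ := max 0 (min 1 ((t - s) / δ))

theorem continuous_rampCutoff (t δ : ℝ) : Continuous (rampCutoff t δ) := by
  unfold rampCutoff
  fun_prop

theorem rampCutoff_mem_Icc (t δ s : ℝ) : rampCutoff t δ s ∈ Icc 0 1 :=
  ⟨le_max_left _ _, max_le zero_le_one (min_le_left _ _)⟩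

theorem rampCutoff_of_le {t δ s : ℝ} (hδ : 0 < δ) (hs : s ≤ t - δ) : rampCutoff t δ s = 1 := by
  have : 1 ≤ (t - s) / δ := by rw [le_div_iff₀ hδ]; linarith
  rw [rampCutoff, min_eq_left this, max_eq_right zero_le_one]

theorem rampCutoff_of_ge {t δ s : ℝ} (hδ : 0 < δ) (hs : t ≤ s) : rampCutoff t δ s = 0 :=
  max_eq_left ((min_le_right _ _).trans (div_nonpos_of_nonpos_of_nonneg (by linarith) hδ.le))

theorem abs_rampCutoff_mul_le (t δ s x : ℝ) : |rampCutoff t δ s * x| ≤ |x| := by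
  obtain ⟨h0, h1⟩ := rampCutoff_mem_Icc t δ s
  rw [abs_mul, abs_of_nonneg h0]
  exact mul_le_of_le_one_left (abs_nonneg x) h1

theorem abs_setIntegral_sub_integral_rampCutoff_le {X : Type*} [MeasurableSpace X] {T : ℝ}
    {ν : Measure (ℝ × X)} (hν : ν.map Prod.fst = volume.restrict (Icc 0 T))
    {f : ℝ × X → ℝ} (hf : Integrable f ν) {C : ℝ} (hC0 : 0 ≤ C) (hC : ∀ p, |f p| ≤ C)
    (t : ℝ) {δ : ℝ} (hδ : 0 < δ) :
    |(∫ p in Icc 0 t ×ˢ (univ : Set X), f p ∂ν) - ∫ p, rampCutoff t δ p.1 * f p ∂ν|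
      ≤ C * δ := by
  have hm : MeasurableSet (Icc 0 t ×ˢ (univ : Set X)) := measurableSet_Icc.prod MeasurableSet.univ
  have hφf : Integrable (fun p : ℝ × X => rampCutoff t δ p.1 * f p) ν := by
    refine hf.mono ?_ (ae_of_all _ fun p => abs_rampCutoff_mul_le t δ p.1 (f p))
    exact (((continuous_rampCutoff t δ).measurable.comp measurable_fst).aestronglyMeasurable).mul
      hf.aestronglyMeasurable
  rw [← integral_indicator hm]
  convert abs_integral_sub_integral_le_of_map_fst hν (hf.indicator hm) hφf hC0
    (sub_le_self t hδ.le) (fun p => ?_) (fun p hp hpt => ?_) using 2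
  · ring
  · refine le_trans ?_ (hC p)
    obtain ⟨h0, h1⟩ := rampCutoff_mem_Icc t δ p.1
    rw [indicator_apply]
    split_ifs
    · rw [← one_sub_mul, abs_mul, abs_of_nonneg (sub_nonneg.2 h1)]
      exact mul_le_of_le_one_left (abs_nonneg _) (by linarith)
    · rw [zero_sub, abs_neg]
      exact abs_rampCutoff_mul_le t δ p.1 (f p)
  · rcases le_or_gt p.1 (t - δ) with h | h
    · rw [rampCutoff_of_le hδ h, one_mul, indicator_of_mem]
      exact ⟨⟨hp.1, by linarith⟩, mem_univ _⟩
    · have ht : t < p.1 := by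
        by_contra! h2
        exact hpt ⟨h, h2⟩
      rw [rampCutoff_of_ge hδ ht.le, zero_mul, indicator_of_notMem]
      exact fun h2 => ht.not_ge h2.1.2

/-- Weak convergence of measures on `ℝ × X` whose first marginal is Lebesgue measure on `[0, T]`
implies convergence of the integrals over `[0, t] × X`, uniformly in `t ∈ [0, T]`. -/
theorem tendstoUniformly_setIntegral_Icc_prod_univ {X : Type*} [TopologicalSpace X]
    [MeasurableSpace X] [OpensMeasurableSpace X] {T : ℝ}
    {ν : ℕ → Measure (ℝ × X)} {μ : Measure (ℝ × X)}
    (hν : ∀ n, (ν n).map Prod.fst = volume.restrict (Icc 0 T))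
    (hμ : μ.map Prod.fst = volume.restrict (Icc 0 T))
    (hconv : ∀ g : ℝ × X → ℝ, Continuous g → (∃ C : ℝ, ∀ p, |g p| ≤ C) →
      Tendsto (fun n => ∫ p, g p ∂(ν n)) atTop (𝓝 (∫ p, g p ∂μ)))
    {f : ℝ × X → ℝ} (hf : Continuous f) {C : NNReal} (hC : ∀ p, |f p| ≤ C) :
    TendstoUniformly
      (fun n (t : Icc (0 : ℝ) T) => ∫ p in Icc (0 : ℝ) t ×ˢ (univ : Set X), f p ∂(ν n))
      (fun t : Icc (0 : ℝ) T => ∫ p in Icc (0 : ℝ) t ×ˢ (univ : Set X), f p ∂μ) atTop := by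
  have hint {ρ : Measure (ℝ × X)} (hρ : ρ.map Prod.fst = volume.restrict (Icc 0 T)) :
      Integrable f ρ := by
    have := isFiniteMeasure_of_map_fst hρ
    exact Integrable.of_bound hf.measurable.aestronglyMeasurable C (ae_of_all _ hC)
  have hequi := (LipschitzWith.uniformEquicontinuous _ C fun n =>
    lipschitzWith_setIntegral_Icc_prod_univ (hν n) (hint (hν n)) hC).equicontinuous
  refine UniformFun.tendsto_iff_tendstoUniformly.1
    ((hequi.tendsto_uniformFun_iff_pi _ _).2 (tendsto_pi_nhds.2 fun t => ?_))
  rw [Metric.tendsto_atTop]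
  intro ε hε
  have hδ : 0 < ε / (3 * (C + 1)) := by positivity
  have hCδ : C * (ε / (3 * (C + 1))) < ε / 3 := by
    have : (C : ℝ) * (ε / (3 * (C + 1))) = ε / 3 * (C / (C + 1)) := by field_simp
    rw [this]
    refine mul_lt_of_lt_one_right (by positivity) ?_
    rw [div_lt_one (by positivity)]
    linarith
  have happrox {ρ : Measure (ℝ × X)} (hρ : ρ.map Prod.fst = volume.restrict (Icc 0 T)) :=
    (abs_setIntegral_sub_integral_rampCutoff_le hρ (hint hρ) C.2 hC t hδ).trans_lt hCδ
  obtain ⟨N, hN⟩ := Metric.tendsto_atTop.1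
    (hconv (fun p => rampCutoff t (ε / (3 * (C + 1))) p.1 * f p)
      (((continuous_rampCutoff _ _).comp continuous_fst).mul hf)
      ⟨C, fun p => (abs_rampCutoff_mul_le _ _ _ _).trans (hC p)⟩) (ε / 3) (by positivity)
  refine ⟨N, fun n hn => ?_⟩
  have h1 := hN n hn
  have h2 := happrox (hν n)
  have h3 := happrox hμ
  rw [Real.dist_eq, abs_lt] at *
  constructor <;> linarith [h1.1, h1.2, h2.1, h2.2, h3.1, h3.2]

theorem tendsto_iSup_abs_sub_of_tendstoUniformly {ι α : Type*} {l : Filter ι}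
    {F : ι → α → ℝ} {g : α → ℝ} (h : TendstoUniformly F g l) :
    Tendsto (fun n => ⨆ x, |F n x - g x|) l (𝓝 0) := by
  rw [Metric.tendsto_nhds]
  intro ε hε
  filter_upwards [Metric.tendstoUniformly_iff.1 h (ε / 2) (half_pos hε)] with n hn
  rw [Real.dist_eq, sub_zero, abs_of_nonneg (Real.iSup_nonneg fun _ => abs_nonneg _)]
  refine (Real.iSup_le (fun x => ?_) (half_pos hε).le).trans_lt (half_lt_self hε)
  rw [abs_sub_comm]
  exact (hn x).le

/-- Chattering lemma, part (ii): if the measures `dt·δ_{u_n(t)}(da)` converge weakly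
to `μ ∈ V`, then for every bounded continuous `f : [0,T] × A → ℝ`,
`∫₀ᵗ f(s, u_n(s)) ds → ∫_{[0,t]×A} f dμ` uniformly in `t ∈ [0,T]`. -/
theorem chattering_uniform_convergence (T : ℝ) (hT : 0 < T)
    (A : Type*) [MetricSpace A] [CompactSpace A] [MeasurableSpace A] [BorelSpace A]
    (μ : MeasureTheory.Measure (ℝ × A))
    (hμ : μ.map Prod.fst = MeasureTheory.volume.restrict (Set.Icc 0 T))
    (u : ℕ → ℝ → A) (humeas : ∀ n, Measurable (u n))
    (hconv : ∀ f : ℝ × A → ℝ, Continuous f → (∃ C : ℝ, ∀ p, |f p| ≤ C) →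
      Filter.Tendsto
        (fun n => ∫ t in Set.Icc (0:ℝ) T, f (t, u n t) ∂MeasureTheory.volume)
        Filter.atTop (nhds (∫ p, f p ∂μ)))
    (f : ℝ × A → ℝ) (hf : Continuous f) (hbd : ∃ C : ℝ, ∀ p, |f p| ≤ C) :
    Filter.Tendsto
      (fun n => ⨆ t : Set.Icc (0:ℝ) T,
        |(∫ s in Set.Icc (0:ℝ) (t : ℝ), f (s, u n s) ∂MeasureTheory.volume) -
          ∫ p in Set.Icc (0:ℝ) (t : ℝ) ×ˢ (Set.univ : Set A), f p ∂μ|)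
      Filter.atTop (nhds 0) := by
  have hpair (n : ℕ) : Measurable fun s => (s, u n s) := measurable_id.prodMk (humeas n)
  obtain ⟨C, hC⟩ := hbd
  have hC' (p : ℝ × A) : |f p| ≤ C.toNNReal := (hC p).trans (Real.le_coe_toNNReal C)
  have hunif := tendstoUniformly_setIntegral_Icc_prod_univ
    (ν := fun n => (volume.restrict (Icc 0 T)).map fun s => (s, u n s)) (fun n => ?_) hμ
    (fun g hg hgb => ?_) hf hC'
  · convert tendsto_iSup_abs_sub_of_tendstoUniformly hunif using 7 with n t
    rw [setIntegral_map (measurableSet_Icc.prod MeasurableSet.univ)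
      hf.measurable.aestronglyMeasurable (hpair n).aemeasurable,
      Measure.restrict_restrict (hpair n (measurableSet_Icc.prod MeasurableSet.univ))]
    congr 2
    ext s
    simp only [mem_inter_iff, mem_preimage, mem_prod, mem_univ, and_true, mem_Icc]
    exact ⟨fun h => ⟨h, h.1, h.2.trans t.2.2⟩, And.left⟩
  · rw [Measure.map_map measurable_fst (hpair n)]
    exact Measure.map_id
  · convert hconv g hg hgb using 2 with n
    exact integral_map (hpair n).aemeasurable hg.measurable.aestronglyMeasurable
end

section
/- (Measurable sliding-control representation.) Let A be a compact metric space, let (κ_t)_{t∈[0,T]} be a Markov kernel from [0,T] to A (κ_t is a Borel probability measure on A for each t, measurably in t), and let f : [0,T] × A → ℝ^m be bounded, jointly Borel measurable, with f(t,·) : A → ℝ^m continuous for each t. Then there exist Borel measurable functions λ_0, …, λ_m : [0,T] → [0,1] with Σ_{i=0}^m λ_i(t) = 1 for all t, and Borel measurable functions u_0, …, u_m : [0,T] → A, such that for Lebesgue-almost every t ∈ [0,T], ∫_A f(t,a) dκ_t(a) = Σ_{i=0}^m λ_i(t) f(t, u_i(t)). -/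
open MeasureTheory ProbabilityTheory

theorem measurableSet_exists_mem_eq_zero {X K : Type*} [MeasurableSpace X] [MetricSpace K]
    [CompactSpace K] {g : X → K → ℝ} (hm : ∀ k, Measurable fun x => g x k)
    (hc : ∀ x, Continuous (g x)) {S : Set K} (hS : IsClosed S) :
    MeasurableSet {x | ∃ k ∈ S, g x k = 0} := by
  obtain ⟨D, hDS, hDc, hSD⟩ :=
    (TopologicalSpace.IsSeparable.of_separableSpace S).exists_countable_dense_subset
  have key : {x | ∃ k ∈ S, g x k = 0} = ⋂ n : ℕ, ⋃ d ∈ D, {x | |g x d| < 1 / ((n : ℝ) + 1)} := by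
    ext x
    simp only [Set.mem_ofPred_eq, Set.mem_iInter, Set.mem_iUnion, exists_prop]
    constructor
    · rintro ⟨k, hkS, hk⟩ n
      have ho : IsOpen {k' | |g x k'| < 1 / ((n : ℝ) + 1)} :=
        isOpen_lt (hc x).abs continuous_const
      have hk' : k ∈ {k' | |g x k'| < 1 / ((n : ℝ) + 1)} := by
        simp only [Set.mem_ofPred_eq, hk, abs_zero]
        positivity
      obtain ⟨d, hd, hdD⟩ := mem_closure_iff.1 (hSD hkS) _ ho hk'
      exact ⟨d, hdD, hd⟩
    · intro h
      obtain ⟨d, hd, -⟩ := h 0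
      obtain ⟨k, hkS, hk⟩ :=
        hS.isCompact.exists_isMinOn ⟨d, hDS hd⟩ (hc x).abs.continuousOn
      refine ⟨k, hkS, ?_⟩
      by_contra hne
      obtain ⟨n, hn⟩ := exists_nat_one_div_lt (abs_pos.2 hne)
      obtain ⟨d, hd, hdn⟩ := h n
      have := isMinOn_iff.1 hk d (hDS hd)
      linarith
  rw [key]
  exact MeasurableSet.iInter fun n => MeasurableSet.biUnion hDc fun d _ =>
    measurableSet_lt (hm d).abs measurable_const

/-- A Carathéodory function on a compact metric space which vanishes somewhere in each section
has a measurable selection of zeros. The least zero is selected after parametrizing the space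
by the Cantor set. -/
theorem exists_measurable_selection_eq_zero {X K : Type*} [MeasurableSpace X] [MetricSpace K]
    [CompactSpace K] [Nonempty K] [MeasurableSpace K] [BorelSpace K] {g : X → K → ℝ}
    (hm : ∀ k, Measurable fun x => g x k) (hc : ∀ x, Continuous (g x))
    (h0 : ∀ x, ∃ k, g x k = 0) :
    ∃ u : X → K, Measurable u ∧ ∀ x, g x (u x) = 0 := by
  obtain ⟨φ, hφ, hφs⟩ := exists_nat_bool_continuous_surjective_of_compact K
  let ψ : cantorSet → K := φ ∘ cantorSetHomeomorphNatToBool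
  have hψ : Continuous ψ := hφ.comp cantorSetHomeomorphNatToBool.continuous
  have hψs : Function.Surjective ψ := hφs.comp cantorSetHomeomorphNatToBool.surjective
  have : CompactSpace cantorSet := isCompact_iff_compactSpace.1 isCompact_cantorSet
  have hleast : ∀ x, ∃ c : cantorSet, g x (ψ c) = 0 ∧ ∀ c', g x (ψ c') = 0 → c ≤ c' := by
    intro x
    have hcl : IsClosed {c | g x (ψ c) = 0} :=
      isClosed_eq ((hc x).comp hψ) continuous_const
    obtain ⟨k, hk⟩ := h0 x
    obtain ⟨c, rfl⟩ := hψs k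
    obtain ⟨c₀, hc₀, hmin⟩ :=
      hcl.isCompact.exists_isMinOn ⟨c, hk⟩ continuous_subtype_val.continuousOn
    exact ⟨c₀, hc₀, fun c' hc' => isMinOn_iff.1 hmin c' hc'⟩
  choose v hv hvmin using hleast
  have hvm : Measurable fun x => (v x : ℝ) := by
    refine measurable_of_Iic fun r => ?_
    have : (fun x => (v x : ℝ)) ⁻¹' Set.Iic r
        = {x | ∃ c ∈ {c : cantorSet | (c : ℝ) ≤ r}, g x (ψ c) = 0} := by
      ext x
      exact ⟨fun h => ⟨v x, h, hv x⟩,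
        fun ⟨c, hcr, hcz⟩ => le_trans (show (v x : ℝ) ≤ c from hvmin x c hcz) hcr⟩
    rw [this]
    exact measurableSet_exists_mem_eq_zero (fun c => hm (ψ c)) (fun x => (hc x).comp hψ)
      (isClosed_le continuous_subtype_val continuous_const)
  exact ⟨ψ ∘ v, hψ.measurable.comp (Measurable.subtype_mk hvm), hv⟩

/-- Carathéodory's theorem with exactly `finrank + 1` points, repetitions being allowed. -/
theorem exists_stdSimplex_sum_eq_of_mem_convexHull_range {A E : Type*} [AddCommGroup E]
    [Module ℝ E] [FiniteDimensional ℝ E] {n : ℕ} (hn : Module.finrank ℝ E = n) {p : A → E} {x : E}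
    (hx : x ∈ convexHull ℝ (Set.range p)) :
    ∃ k : stdSimplex ℝ (Fin (n + 1)) × (Fin (n + 1) → A), ∑ i, k.1.1 i • p (k.2 i) = x := by
  obtain ⟨ι, _, z, w, hz, hind, hw, hw1, hwx⟩ := eq_pos_convex_span_of_mem_convexHull hx
  have hcard : Fintype.card ι ≤ Fintype.card (Fin (n + 1)) := by
    have h1 := hind.card_le_finrank_succ
    have h2 := Submodule.finrank_le (vectorSpan ℝ (Set.range z))
    simp only [Fintype.card_fin]
    omega
  obtain ⟨e⟩ := Function.Embedding.nonempty_of_card_le hcard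
  choose a ha using fun i => hz (Set.mem_range_self i)
  obtain ⟨_, a₀, -⟩ := convexHull_nonempty_iff.1 ⟨x, hx⟩
  have hw_ext (j) (hj : j ∉ Set.range e) : Function.extend e w 0 j = 0 :=
    Function.extend_apply' _ _ _ hj
  refine ⟨⟨⟨Function.extend e w 0, fun j => ?_, ?_⟩, Function.extend e a fun _ => a₀⟩, ?_⟩
  · by_cases hj : j ∈ Set.range e
    · obtain ⟨i, rfl⟩ := hj
      rw [e.injective.extend_apply]
      exact (hw i).le
    · exact (hw_ext j hj).ge
  · rw [← hw1]
    exact (Fintype.sum_of_injective e e.injective _ _ hw_ext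
      fun i => (e.injective.extend_apply _ _ _).symm).symm
  · rw [← hwx]
    refine (Fintype.sum_of_injective e e.injective _ _ (fun j hj => ?_) fun i => ?_).symm
    · simp only [hw_ext j hj, zero_smul]
    · simp only [e.injective.extend_apply, ha]

theorem continuous_stdSimplex_sum_smul {A E ι : Type*} [Fintype ι] [TopologicalSpace A]
    [AddCommGroup E] [Module ℝ E] [TopologicalSpace E] [ContinuousAdd E] [ContinuousSMul ℝ E]
    {p : A → E} (hp : Continuous p) :
    Continuous fun k : stdSimplex ℝ ι × (ι → A) => ∑ i, k.1.1 i • p (k.2 i) :=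
  continuous_finsetSum _ fun i _ =>
    ((continuous_apply i).comp (continuous_subtype_val.comp continuous_fst)).smul
      (hp.comp ((continuous_apply i).comp continuous_snd))

theorem exists_stdSimplex_sum_eq_integral {A E : Type*} [TopologicalSpace A] [CompactSpace A]
    [MeasurableSpace A] [OpensMeasurableSpace A] [NormedAddCommGroup E] [NormedSpace ℝ E]
    [FiniteDimensional ℝ E] {n : ℕ} (hn : Module.finrank ℝ E = n) (μ : Measure A)
    [IsProbabilityMeasure μ] {p : A → E} (hp : Continuous p) :
    ∃ k : stdSimplex ℝ (Fin (n + 1)) × (Fin (n + 1) → A),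
      ∑ i, k.1.1 i • p (k.2 i) = ∫ a, p a ∂μ := by
  have hrange : convexHull ℝ (Set.range p) = Set.range
      fun k : stdSimplex ℝ (Fin (n + 1)) × (Fin (n + 1) → A) => ∑ i, k.1.1 i • p (k.2 i) := by
    refine Set.Subset.antisymm
      (fun x hx => exists_stdSimplex_sum_eq_of_mem_convexHull_range hn hx) ?_
    rintro _ ⟨k, rfl⟩
    exact (convex_convexHull ℝ _).sum_mem (fun i _ => k.1.2.1 i) k.1.2.2
      fun i _ => subset_convexHull ℝ _ (Set.mem_range_self _)
  have hclosed : IsClosed (convexHull ℝ (Set.range p)) := by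
    rw [hrange]
    exact (isCompact_range (continuous_stdSimplex_sum_smul hp)).isClosed
  refine exists_stdSimplex_sum_eq_of_mem_convexHull_range hn
    ((convex_convexHull ℝ _).integral_mem hclosed
      (ae_of_all _ fun a => subset_convexHull ℝ _ (Set.mem_range_self a)) ?_)
  exact hp.integrable_of_hasCompactSupport (HasCompactSupport.of_compactSpace p)

open MeasureTheory ProbabilityTheory

/-- Measurable sliding-control representation: for a Markov kernel `(κ_t)` from `[0,T]`
to a compact metric space `A` and a bounded, jointly measurable `f : [0,T] × A → ℝ^m`
with `f(t,·)` continuous, there are measurable weights `λ_0,…,λ_m : [0,T] → [0,1]`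
summing to `1` and measurable `u_0,…,u_m : [0,T] → A` with
`∫ f(t,a) dκ_t(a) = Σ_i λ_i(t) f(t, u_i(t))` for Lebesgue-a.e. `t`. -/
theorem sliding_control_representation (m : ℕ) (T : ℝ) (hT : 0 < T)
    (A : Type*) [MetricSpace A] [CompactSpace A] [MeasurableSpace A] [BorelSpace A]
    (κ : ProbabilityTheory.Kernel (Set.Icc (0:ℝ) T) A) [ProbabilityTheory.IsMarkovKernel κ]
    (f : Set.Icc (0:ℝ) T → A → EuclideanSpace ℝ (Fin m))
    (hbd : ∃ C : ℝ, ∀ t a, ‖f t a‖ ≤ C)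
    (hmeas : Measurable (Function.uncurry f))
    (hcont : ∀ t, Continuous (f t)) :
    ∃ (lam : Fin (m + 1) → Set.Icc (0:ℝ) T → ℝ) (u : Fin (m + 1) → Set.Icc (0:ℝ) T → A),
      (∀ i, Measurable (lam i)) ∧ (∀ i, Measurable (u i)) ∧
      (∀ t, ∀ i, lam i t ∈ Set.Icc (0:ℝ) 1) ∧ (∀ t, ∑ i, lam i t = 1) ∧
      (∀ᵐ t ∂(MeasureTheory.volume.comap Subtype.val :
          MeasureTheory.Measure (Set.Icc (0:ℝ) T)),
        ∫ a, f t a ∂(κ t) = ∑ i, lam i t • f t (u i t)) := by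
  have : Nonempty A := (κ ⟨0, le_rfl, hT.le⟩).nonempty_of_neZero
  let g : Set.Icc (0:ℝ) T → stdSimplex ℝ (Fin (m + 1)) × (Fin (m + 1) → A) → ℝ :=
    fun t k => ‖∑ i, k.1.1 i • f t (k.2 i) - ∫ a, f t a ∂(κ t)‖
  have hg_meas (k) : Measurable fun t => g t k := by
    have hint : Measurable fun t => ∫ a, f t a ∂(κ t) :=
      hmeas.stronglyMeasurable.integral_kernel_prod_right.measurable
    have hf (a : A) : Measurable fun t => f t a := hmeas.of_uncurry_right
    have hsum : Measurable fun t => ∑ i, k.1.1 i • f t (k.2 i) :=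
      Finset.measurable_fun_sum _ fun i _ => (hf (k.2 i)).const_smul (k.1.1 i)
    exact (hsum.sub hint).norm
  have hg_cont (t) : Continuous (g t) :=
    ((continuous_stdSimplex_sum_smul (hcont t)).sub continuous_const).norm
  have hg_zero (t) : ∃ k, g t k = 0 := by
    obtain ⟨k, hk⟩ := exists_stdSimplex_sum_eq_integral finrank_euclideanSpace_fin (κ t) (hcont t)
    exact ⟨k, by simp [g, hk]⟩
  obtain ⟨k, hk, hk0⟩ := exists_measurable_selection_eq_zero hg_meas hg_cont hg_zero
  refine ⟨fun i t => (k t).1.1 i, fun i t => (k t).2 i,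
    fun i => (measurable_pi_apply i).comp (measurable_subtype_coe.comp hk.fst),
    fun i => (measurable_pi_apply i).comp hk.snd,
    fun t i => mem_Icc_of_mem_stdSimplex (k t).1.2 i, fun t => (k t).1.2.2, ae_of_all _ fun t => ?_⟩
  · exact (sub_eq_zero.1 (norm_eq_zero.1 (hk0 t))).symm
end

section
/- (Filippov convexity condition, measurable version.) Let A be a compact metric space, let (κ_t)_{t∈[0,T]} be a Markov kernel from [0,T] to A, and let f : [0,T] × A → ℝ^m be bounded, jointly Borel measurable, with f(t,·) continuous for each t. Assume moreover that for every t ∈ [0,T] the set {f(t,a) : a ∈ A} ⊂ ℝ^m is convex. Then there exists a Borel measurable function u : [0,T] → A such that for Lebesgue-almost every t ∈ [0,T], ∫_A f(t,a) dκ_t(a) = f(t, u(t)). -/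
open MeasureTheory ProbabilityTheory

/-- If `h t` is continuous for each `t` and `h · x` is measurable for each `x`, then the set of
parameters `t` for which `h t` attains a value `≤ 0` on a given compact set is measurable. -/
theorem measurableSet_exists_mem_le_zero {S X : Type*} [MeasurableSpace S] [TopologicalSpace X]
    [SecondCountableTopology X] {h : S → X → ℝ} (hmeas : ∀ x, Measurable fun t => h t x)
    (hcont : ∀ t, Continuous (h t)) {C : Set X} (hC : IsCompact C) :
    MeasurableSet {t | ∃ x ∈ C, h t x ≤ 0} := by
  rcases C.eq_empty_or_nonempty with rfl | hne
  · simp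
  have : Nonempty C := hne.to_subtype
  have key : {t | ∃ x ∈ C, h t x ≤ 0} =
      ⋂ n : ℕ, ⋃ k : ℕ, {t | h t (TopologicalSpace.denseSeq C k) < 1 / ((n : ℝ) + 1)} := by
    ext t
    simp only [Set.mem_ofPred_eq, Set.mem_iInter, Set.mem_iUnion]
    constructor
    · rintro ⟨x, hx, hle⟩ n
      obtain ⟨k, hk⟩ := (TopologicalSpace.denseRange_denseSeq C).exists_mem_open
        (isOpen_Iio.preimage ((hcont t).comp continuous_subtype_val))
        ⟨⟨x, hx⟩, show h t x < 1 / ((n : ℝ) + 1) from hle.trans_lt (by positivity)⟩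
      exact ⟨k, hk⟩
    · intro H
      obtain ⟨x, hx, hmin⟩ := hC.exists_isMinOn hne (hcont t).continuousOn
      refine ⟨x, hx, le_of_forall_pos_lt_add fun ε hε => ?_⟩
      obtain ⟨n, hn⟩ := exists_nat_one_div_lt hε
      obtain ⟨k, hk⟩ := H n
      have := isMinOn_iff.1 hmin _ (TopologicalSpace.denseSeq C k).2
      linarith
  rw [key]
  exact .iInter fun n => .iUnion fun k => measurableSet_lt (hmeas _) measurable_const

/-- A function continuous in a variable ranging over a compact subset of the real line and
measurable in the parameter has a measurable selection of points where it is `≤ 0`, namely the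
least such point. -/
theorem exists_measurable_le_zero_of_real {S : Type*} [MeasurableSpace S] {K : Set ℝ}
    (hK : IsCompact K) {h : S → K → ℝ} (hmeas : ∀ x, Measurable fun t => h t x)
    (hcont : ∀ t, Continuous (h t)) (hex : ∀ t, ∃ x, h t x ≤ 0) :
    ∃ s : S → K, Measurable s ∧ ∀ t, h t (s t) ≤ 0 := by
  have : CompactSpace K := isCompact_iff_compactSpace.1 hK
  have hleast : ∀ t, ∃ x, IsLeast {x | h t x ≤ 0} x := fun t =>
    (isClosed_le (hcont t) continuous_const).isCompact.exists_isLeast (hex t)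
  choose s hs using hleast
  refine ⟨s, ?_, fun t => (hs t).1⟩
  refine Measurable.subtype_mk (f := fun t => (s t : ℝ)) (measurable_of_Iic fun c => ?_)
  convert measurableSet_exists_mem_le_zero hmeas hcont
    (isClosed_Iic.preimage continuous_subtype_val : IsClosed {x : K | (x : ℝ) ≤ c}).isCompact
    using 1
  ext t
  exact ⟨fun ht => ⟨s t, ht, (hs t).1⟩, fun ⟨_, hx, hle⟩ =>
    Set.mem_preimage.2 (Set.mem_Iic.2 (le_trans (Subtype.coe_le_coe.2 ((hs t).2 hle)) hx))⟩

/-- A measurable selection theorem: a function continuous in a variable ranging over a compact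
metric space and measurable in the parameter has a measurable selection of points where it
is `≤ 0`. -/
theorem exists_measurable_le_zero {S A : Type*} [MeasurableSpace S] [MetricSpace A]
    [CompactSpace A] [Nonempty A] [MeasurableSpace A] [BorelSpace A] {h : S → A → ℝ}
    (hmeas : ∀ a, Measurable fun t => h t a) (hcont : ∀ t, Continuous (h t))
    (hex : ∀ t, ∃ a, h t a ≤ 0) : ∃ u : S → A, Measurable u ∧ ∀ t, h t (u t) ≤ 0 := by
  obtain ⟨φ, hφ, hsurj⟩ := exists_nat_bool_continuous_surjective_of_compact A
  have hψ : Continuous (φ ∘ cantorSetHomeomorphNatToBool) :=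
    hφ.comp cantorSetHomeomorphNatToBool.continuous
  obtain ⟨s, hs, hle⟩ := exists_measurable_le_zero_of_real isCompact_cantorSet
    (h := fun t x => h t (φ (cantorSetHomeomorphNatToBool x))) (fun _ => hmeas _)
    (fun t => (hcont t).comp hψ) fun t => by
      obtain ⟨a, ha⟩ := hex t
      obtain ⟨x, rfl⟩ := (hsurj.comp cantorSetHomeomorphNatToBool.surjective) a
      exact ⟨x, ha⟩
  exact ⟨_, hψ.measurable.comp hs, hle⟩

/-- Filippov convexity condition, measurable version: if moreover the set
`{f(t,a) : a ∈ A}` is convex for every `t`, then there is a single measurable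
selection `u : [0,T] → A` with `∫ f(t,a) dκ_t(a) = f(t, u(t))` for Lebesgue-a.e. `t`. -/
theorem filippov_measurable_selection (m : ℕ) (T : ℝ) (hT : 0 < T)
    (A : Type*) [MetricSpace A] [CompactSpace A] [MeasurableSpace A] [BorelSpace A]
    (κ : ProbabilityTheory.Kernel (Set.Icc (0:ℝ) T) A) [ProbabilityTheory.IsMarkovKernel κ]
    (f : Set.Icc (0:ℝ) T → A → EuclideanSpace ℝ (Fin m))
    (hbd : ∃ C : ℝ, ∀ t a, ‖f t a‖ ≤ C)
    (hmeas : Measurable (Function.uncurry f))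
    (hcont : ∀ t, Continuous (f t))
    (hconv : ∀ t, Convex ℝ (Set.range (f t))) :
    ∃ u : Set.Icc (0:ℝ) T → A, Measurable u ∧
      (∀ᵐ t ∂(MeasureTheory.volume.comap Subtype.val :
          MeasureTheory.Measure (Set.Icc (0:ℝ) T)),
        ∫ a, f t a ∂(κ t) = f t (u t)) := by
  obtain ⟨C, hC⟩ := hbd
  have : Nonempty A := nonempty_of_isProbabilityMeasure (κ ⟨0, le_rfl, hT.le⟩)
  have hg : Measurable fun t => ∫ a, f t a ∂(κ t) :=
    (hmeas.stronglyMeasurable.integral_kernel_prod_right (κ := κ)).measurable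
  have hmem : ∀ t, ∫ a, f t a ∂(κ t) ∈ Set.range (f t) := fun t =>
    (hconv t).integral_mem (isCompact_range (hcont t)).isClosed
      (.of_forall fun a => Set.mem_range_self a)
      (.of_bound (hcont t).measurable.aestronglyMeasurable C (.of_forall (hC t)))
  obtain ⟨u, hu, hle⟩ := exists_measurable_le_zero
    (h := fun t a => dist (∫ b, f t b ∂(κ t)) (f t a))
    (fun a => hg.dist (hmeas.comp (measurable_id.prodMk measurable_const)))
    (fun t => continuous_const.dist (hcont t)) fun t => by
      obtain ⟨a, ha⟩ := hmem t
      exact ⟨a, by simp [ha]⟩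
  exact ⟨u, hu, .of_forall fun t => dist_le_zero.1 (hle t)⟩
end
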